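/- Let Q be the 3-dimensional real Leibniz algebra with bracket determined by [f,g]=f, [g,f]=−f, [g,g]=e (all other brackets of basis vectors zero). A linear map N : Q → Q is a Nijenhuis operator on Q if and only if its matrix (rows = coordinates of N(e), N(f), N(g) in the basis {e,f,g}) has one of the following forms for real parameters: (1) rows (k₁,0,0), (ℓ₁,ℓ₂,0), (p₁,p₂,k₁); (2) rows (k₁,k₂,0), (0,k₁,0), (p₁,p₂,k₁) with k₂≠0. -/

import Mathlib

/-- Bracket of the 3-dim real Leibniz algebra with [f,g]=f, [g,f]=-f, [g,g]=e
(basis e,f,g ↔ indices 0,1,2). -/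
noncomputable def br (x y : Fin 3 → ℝ) : Fin 3 → ℝ :=
  ![x 2 * y 2, x 1 * y 2 - x 2 * y 1, 0]

/-- A linear map on `Fin 3 → ℝ` is determined by its values on the standard basis. -/
theorem map_eq_sum_basis (N : (Fin 3 → ℝ) →ₗ[ℝ] (Fin 3 → ℝ)) (x : Fin 3 → ℝ) :
    N x = x 0 • N ![1,0,0] + x 1 • N ![0,1,0] + x 2 • N ![0,0,1] := by
  rw [← map_smul, ← map_smul, ← map_smul, ← map_add, ← map_add]
  congr 1
  ext i
  fin_cases i <;> simp

theorem nijenhuis_classification_thm2_4 (N : (Fin 3 → ℝ) →ₗ[ℝ] (Fin 3 → ℝ)) :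
    (∀ x y, br (N x) (N y) + N (N (br x y)) = N (br (N x) y) + N (br x (N y)))
    ↔
    ((∃ k₁ ℓ₁ ℓ₂ p₁ p₂ : ℝ,
        N ![1,0,0] = ![k₁,0,0] ∧ N ![0,1,0] = ![ℓ₁,ℓ₂,0] ∧ N ![0,0,1] = ![p₁,p₂,k₁]) ∨
     (∃ k₁ k₂ p₁ p₂ : ℝ, k₂ ≠ 0 ∧
        N ![1,0,0] = ![k₁,k₂,0] ∧ N ![0,1,0] = ![0,k₁,0] ∧ N ![0,0,1] = ![p₁,p₂,k₁])) := by
  constructor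
  · intro h
    obtain ⟨k, hk⟩ : ∃ k, N ![1,0,0] = k := ⟨_, rfl⟩
    obtain ⟨l, hl⟩ : ∃ l, N ![0,1,0] = l := ⟨_, rfl⟩
    obtain ⟨p, hp⟩ : ∃ p, N ![0,0,1] = p := ⟨_, rfl⟩
    have hN (x) : N x = x 0 • k + x 1 • l + x 2 • p := by
      rw [map_eq_sum_basis, hk, hl, hp]
    have hee := congrFun (h ![1,0,0] ![1,0,0]) 0
    have hff := congrFun (h ![0,1,0] ![0,1,0]) 0
    have heg₀ := congrFun (h ![1,0,0] ![0,0,1]) 0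
    have heg₁ := congrFun (h ![1,0,0] ![0,0,1]) 1
    have hgg₀ := congrFun (h ![0,0,1] ![0,0,1]) 0
    simp [hN, br] at hee hff heg₀ heg₁ hgg₀
    simp [hee] at heg₀ heg₁ hgg₀
    have hkl : k 1 * l 0 = 0 := by
      rcases heg₀ with h0 | h0 <;> simp [h0]
    have hpk : p 2 = k 0 := by
      have : (p 2 - k 0) ^ 2 = 0 := by linear_combination hgg₀ - hkl
      exact sub_eq_zero.mp (pow_eq_zero_iff two_ne_zero |>.mp this)
    by_cases hk1 : k 1 = 0
    · refine Or.inl ⟨k 0, l 0, l 1, p 0, p 1, ?_, ?_, ?_⟩ <;>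
        ext i <;> fin_cases i <;> simp [*]
    · have hl0 : l 0 = 0 := (mul_eq_zero.mp hkl).resolve_left hk1
      have hl1 : l 1 = k 0 := by grind
      refine Or.inr ⟨k 0, k 1, p 0, p 1, hk1, ?_, ?_, ?_⟩ <;>
        ext i <;> fin_cases i <;> simp [*]
  · rintro (⟨k₁, ℓ₁, ℓ₂, p₁, p₂, hk, hl, hp⟩ | ⟨k₁, k₂, p₁, p₂, -, hk, hl, hp⟩) x y <;>
    · have hN := map_eq_sum_basis N
      simp only [hk, hl, hp] at hN
      ext i
      fin_cases i <;> simp [hN, br] <;> ring
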